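/- arXiv:2406.03268 — 3 statements merged into one kernel-verified Lean document; each statement's English description precedes it below -/
import Mathlib

section
/- Let ε > 0, λ > 0, a ∈ ℝ, Δx > 0. Let (u_i, v_i)_{i∈ℤ} be time-differentiable sequences solving the semi-discrete HLL scheme: du_i/dt = −(v_{i+1} − v_{i−1})/(2Δx) + (λ/(2Δx))(u_{i+1} − 2u_i + u_{i−1}) and dv_i/dt = −(λ²/(2ε²Δx))(u_{i+1} − u_{i−1}) + (λ/(2Δx))(v_{i+1} − 2v_i + v_{i−1}) + (a u_i − v_i)/ε². Let (ū_i, v̄_i)_{i∈ℤ} solve the semi-discrete limit scheme: dū_i/dt = −(v̄_{i+1} − v̄_{i−1})/(2Δx) + (λ/(2Δx))(ū_{i+1} − 2ū_i + ū_{i−1}) and (λ²/(2Δx))(ū_{i+1} − ū_{i−1}) = a ū_i − v̄_i, with v̄_i differentiable in time. Then the discrete relative entropy E_i = (λ²/2)(u_i−ū_i)² + (ε²/2)(v_i−v̄_i)² − ε² a (u_i−ū_i)(v_i−v̄_i) satisfies, for each i ∈ ℤ and each time t, dE_i/dt + (F_{i+1/2} − F_{i−1/2})/Δx = −[a(u_i−ū_i)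 − (v_i−v̄_i)]² + ε² [a(u_i−ū_i) − (v_i−v̄_i)] dv̄_i/dt + R_i¹ + R_i² + R_i³ + R_i⁴, where F_{i+1/2} = −(ε²a/2)(v_i−v̄_i)(v_{i+1}−v̄_{i+1}) − (λ²a/2)(u_i−ū_i)(u_{i+1}−ū_{i+1}) + (λ²/2)[(u_i−ū_i)(v_{i+1}−v̄_{i+1}) + (u_{i+1}−ū_{i+1})(v_i−v̄_i)], and R_i¹ = (λ³/2) Δx (u_i−ū_i)(D_{xx}(u−ū))_i, R_i² = (ε²λ/2) Δx (v_i−v̄_i)(D_{xx}(v−v̄))_i, R_i³ = (ε²λ/2) Δx [(v_i−v̄_i) − a(u_i−ū_i)](D_{xx} v̄)_i, R_i⁴ = −ε² a (λ/2) Δx [(v_i−v̄_i)(D_{xx}(u−ū))_i + (u_i−ū_i)(D_{xx}(v−v̄))_i]. -/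
/- Discrete second difference: (D_{xx} w)_i = (w_{i+1} − 2w_i + w_{i−1}) / Δx². -/
noncomputable def Dxx (dx : ℝ) (w : ℤ → ℝ) (i : ℤ) : ℝ :=
  (w (i + 1) - 2 * w i + w (i - 1)) / dx ^ 2

/- Discrete relative entropy E_i. -/
noncomputable def discreteRelEntropy (ε lam a : ℝ) (u v ub vb : ℤ → ℝ → ℝ)
    (i : ℤ) (t : ℝ) : ℝ :=
  lam ^ 2 / 2 * (u i t - ub i t) ^ 2 + ε ^ 2 / 2 * (v i t - vb i t) ^ 2
    - ε ^ 2 * a * (u i t - ub i t) * (v i t - vb i t)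

/- Discrete relative entropy flux F_{i+1/2}. -/
noncomputable def discreteRelEntropyFlux (ε lam a : ℝ) (u v ub vb : ℤ → ℝ → ℝ)
    (i : ℤ) (t : ℝ) : ℝ :=
  -(ε ^ 2 * a / 2) * (v i t - vb i t) * (v (i + 1) t - vb (i + 1) t)
    - lam ^ 2 * a / 2 * (u i t - ub i t) * (u (i + 1) t - ub (i + 1) t)
    + lam ^ 2 / 2 * ((u i t - ub i t) * (v (i + 1) t - vb (i + 1) t)
        + (u (i + 1) t - ub (i + 1) t) * (v i t - vb i t))

/- STATEMENT 7: Semi-discrete relative entropy evolution identity: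
   dE_i/dt + (F_{i+1/2} − F_{i−1/2})/Δx
     = −[a(u_i−ū_i) − (v_i−v̄_i)]² + ε²[a(u_i−ū_i) − (v_i−v̄_i)] dv̄_i/dt
       + R_i¹ + R_i² + R_i³ + R_i⁴. -/
theorem discrete_relative_entropy_identity
    (ε lam a dx : ℝ) (hε : 0 < ε) (hlam : 0 < lam) (hdx : 0 < dx)
    (u v ub vb : ℤ → ℝ → ℝ)
    -- (u_i, v_i) solves the semi-discrete HLL scheme
    (hscheme_u : ∀ (i : ℤ) (t : ℝ), HasDerivAt (fun τ => u i τ)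
      (-(v (i + 1) t - v (i - 1) t) / (2 * dx)
        + lam / (2 * dx) * (u (i + 1) t - 2 * u i t + u (i - 1) t)) t)
    (hscheme_v : ∀ (i : ℤ) (t : ℝ), HasDerivAt (fun τ => v i τ)
      (-(lam ^ 2 / (2 * ε ^ 2 * dx)) * (u (i + 1) t - u (i - 1) t)
        + lam / (2 * dx) * (v (i + 1) t - 2 * v i t + v (i - 1) t)
        + (a * u i t - v i t) / ε ^ 2) t)
    -- (ū_i, v̄_i) solves the semi-discrete limit scheme, v̄_i differentiable in time
    (hlim_u : ∀ (i : ℤ) (t : ℝ), HasDerivAt (fun τ => ub i τ)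
      (-(vb (i + 1) t - vb (i - 1) t) / (2 * dx)
        + lam / (2 * dx) * (ub (i + 1) t - 2 * ub i t + ub (i - 1) t)) t)
    (hlim_v : ∀ (i : ℤ) (t : ℝ),
      lam ^ 2 / (2 * dx) * (ub (i + 1) t - ub (i - 1) t) = a * ub i t - vb i t)
    (hvb_diff : ∀ i : ℤ, Differentiable ℝ (fun τ => vb i τ)) :
    ∀ (i : ℤ) (t : ℝ),
      deriv (fun τ => discreteRelEntropy ε lam a u v ub vb i τ) t
        + (discreteRelEntropyFlux ε lam a u v ub vb i t
            - discreteRelEntropyFlux ε lam a u v ub vb (i - 1) t) / dx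
      = -(a * (u i t - ub i t) - (v i t - vb i t)) ^ 2
        + ε ^ 2 * (a * (u i t - ub i t) - (v i t - vb i t))
            * deriv (fun τ => vb i τ) t
        + lam ^ 3 / 2 * dx * (u i t - ub i t)
            * Dxx dx (fun j => u j t - ub j t) i
        + ε ^ 2 * lam / 2 * dx * (v i t - vb i t)
            * Dxx dx (fun j => v j t - vb j t) i
        + ε ^ 2 * lam / 2 * dx * ((v i t - vb i t) - a * (u i t - ub i t))
            * Dxx dx (fun j => vb j t) i
        + -(ε ^ 2 * a * lam / 2) * dx
            * ((v i t - vb i t) * Dxx dx (fun j => u j t - ub j t) i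
              + (u i t - ub i t) * Dxx dx (fun j => v j t - vb j t) i) := by
  intro i t
  have hvb : HasDerivAt (fun τ => vb i τ) (deriv (fun τ => vb i τ) t) t :=
    (hvb_diff i t).hasDerivAt
  have hp := (hscheme_u i t).sub (hlim_u i t)
  have hq := (hscheme_v i t).sub hvb
  have hE := (((hp.pow 2).const_mul (lam ^ 2 / 2)).add
    ((hq.pow 2).const_mul (ε ^ 2 / 2))).sub ((hp.const_mul (ε ^ 2 * a)).mul hq)
  have hE' : deriv (fun τ => discreteRelEntropy ε lam a u v ub vb i τ) t = _ := hE.deriv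
  rw [hE']
  have hl := hlim_v i t
  generalize deriv (fun τ => vb i τ) t = d
  have hε0 : ε ≠ 0 := hε.ne'
  have hdx0 : dx ≠ 0 := hdx.ne'
  simp only [discreteRelEntropyFlux, Dxx, sub_add_cancel, Pi.sub_apply, Nat.cast_ofNat,
    Nat.add_one_sub_one, pow_one]
  clear hE' hE hq hp hvb hvb_diff hlim_v hlim_u hscheme_v hscheme_u
  generalize u (i + 1) t = u1 at *
  generalize u (i - 1) t = u2 at *
  generalize u i t = u0 at *
  generalize v (i + 1) t = v1 at *
  generalize v (i - 1) t = v2 at *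
  generalize v i t = v0 at *
  generalize ub (i + 1) t = b1 at *
  generalize ub (i - 1) t = b2 at *
  generalize ub i t = b0 at *
  generalize vb (i + 1) t = c1 at *
  generalize vb (i - 1) t = c2 at *
  generalize vb i t = c0 at *
  have hvt : c0 = a * b0 - lam ^ 2 / (2 * dx) * (b1 - b2) := by linarith
  subst hvt
  field_simp
  ring
end

section
/- Let ε > 0, λ > 0, a ∈ ℝ satisfy the subcharacteristic condition λ > ε|a|, and let Δx > 0, t > 0. Let (u_i, v_i)_{i∈ℤ} and (ū_i, v̄_i)_{i∈ℤ} be time-dependent sequences on [0,t] such that for each s ∈ [0,t], u_i(s) − ū_i(s) → 0 and v_i(s) − v̄_i(s) → 0 as i → ±∞, the norms ‖D_x(u−ū)‖_{L²(Q_t)} and ‖D_x(v−v̄)‖_{L²(Q_t)} are finite, and all sums involved converge absolutely. Then, with R_i⁴ = −ε² a (λ/2) Δx [(v_i−v̄_i)(D_{xx}(u−ū))_i + (u_i−ū_i)(D_{xx}(v−v̄))_i], one has ∫₀^t Σ_{i∈ℤ} Δx R_i⁴ ds ≤ (λ³/2) Δx ‖D_x(u−ū)‖²_{L²(Q_t)}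 + (λ/2) ε² Δx ‖D_x(v−v̄)‖²_{L²(Q_t)}. -/
open Filter Topology

/- Discrete first difference at the interface i+1/2: (D_x w)_{i+1/2} = (w_{i+1} − w_i)/Δx. -/
noncomputable def Dx (dx : ℝ) (w : ℤ → ℝ) (i : ℤ) : ℝ := (w (i + 1) - w i) / dx

/- Squared discrete space-time L² norm: ‖w‖²_{L²(Q_t)} = ∫₀^t Σ_i Δx |w_i(s)|² ds. -/
noncomputable def L2sq (dx t : ℝ) (w : ℤ → ℝ → ℝ) : ℝ :=
  ∫ s in (0:ℝ)..t, ∑' i : ℤ, dx * (w i s) ^ 2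

theorem telescoping_int_tsum (T : ℤ → ℝ) (h1 : Tendsto T atTop (nhds 0))
    (h2 : Tendsto T atBot (nhds 0)) (hs : Summable (fun i : ℤ => T (i + 1) - T i)) :
    ∑' i : ℤ, (T (i + 1) - T i) = 0 := by
  have ha : Summable (fun n : ℕ => T ((n : ℤ) + 1) - T (n : ℤ)) :=
    hs.comp_injective (i := fun n : ℕ => (n : ℤ)) Nat.cast_injective
  have hb : Summable (fun n : ℕ => T (-((n : ℤ) + 1) + 1) - T (-((n : ℤ) + 1))) :=
    hs.comp_injective (i := fun n : ℕ => -((n : ℤ) + 1)) (by intro m n h; simpa using h)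
  have hcast : Tendsto (fun n : ℕ => (n : ℤ)) atTop atTop := tendsto_natCast_atTop_atTop
  have ea : HasSum (fun n : ℕ => T ((n : ℤ) + 1) - T (n : ℤ)) (0 - T 0) := by
    have h := ha.hasSum.tendsto_sum_nat
    have e : ∀ n : ℕ, ∑ i ∈ Finset.range n, (T ((i : ℤ) + 1) - T (i : ℤ)) = T n - T 0 := by
      intro n
      have := Finset.sum_range_sub (fun k : ℕ => T (k : ℤ)) n
      simpa using this
    simp only [e] at h
    have h' := (h1.comp hcast).sub_const (T 0)
    rw [tendsto_nhds_unique h' h]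
    exact ha.hasSum
  have eb : HasSum (fun n : ℕ => T (-((n : ℤ) + 1) + 1) - T (-((n : ℤ) + 1))) (T 0 - 0) := by
    have h := hb.hasSum.tendsto_sum_nat
    have e : ∀ n : ℕ, ∑ i ∈ Finset.range n, (T (-((i : ℤ) + 1) + 1) - T (-((i : ℤ) + 1)))
        = T 0 - T (-(n : ℤ)) := by
      intro n
      have := Finset.sum_range_sub' (fun k : ℕ => T (-(k : ℤ))) n
      simpa using this
    simp only [e] at h
    have h' := (h2.comp (tendsto_neg_atTop_atBot.comp hcast)).const_sub (T 0)
    rw [tendsto_nhds_unique h' h]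
    exact hb.hasSum
  have := (HasSum.of_nat_of_neg_add_one (f := fun i : ℤ => T (i + 1) - T i) ea eb).tsum_eq
  rw [this]; ring

theorem sum_by_parts_int (dx : ℝ) (hdx : 0 < dx) (p q : ℤ → ℝ)
    (hp1 : Tendsto p atTop (nhds 0)) (hp2 : Tendsto p atBot (nhds 0))
    (hq1 : Tendsto q atTop (nhds 0)) (hq2 : Tendsto q atBot (nhds 0))
    (hs : Summable (fun i => q i * Dxx dx p i))
    (hd : Summable (fun i => Dx dx p i * Dx dx q i)) :
    ∑' i, q i * Dxx dx p i = - ∑' i, Dx dx p i * Dx dx q i := by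
  have key : ∀ i, q (i + 1) * (p (i + 1) - p (i + 1 - 1)) - q i * (p i - p (i - 1))
      = dx ^ 2 * (q i * Dxx dx p i + Dx dx p i * Dx dx q i) := by
    intro i
    simp only [Dxx, Dx, add_sub_cancel_right]
    field_simp
    ring
  have t1 : Tendsto (fun i : ℤ => q i * (p i - p (i - 1))) atTop (nhds 0) := by
    have := hq1.mul (hp1.sub (hp1.comp (tendsto_atTop_add_const_right atTop (-1 : ℤ) tendsto_id)))
    simpa [Function.comp_def, sub_eq_add_neg] using this
  have t2 : Tendsto (fun i : ℤ => q i * (p i - p (i - 1))) atBot (nhds 0) := by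
    have := hq2.mul (hp2.sub (hp2.comp (tendsto_atBot_add_const_right atBot (-1 : ℤ) tendsto_id)))
    simpa [Function.comp_def, sub_eq_add_neg] using this
  have h := telescoping_int_tsum (fun i : ℤ => q i * (p i - p (i - 1))) t1 t2
    (by simp only [key]; exact (hs.add hd).mul_left _)
  simp only [key] at h
  rw [tsum_mul_left, hs.tsum_add hd] at h
  have := (mul_eq_zero.mp h).resolve_left (by positivity)
  linarith

theorem pointwise_R4 (ε lam a dx : ℝ) (hε : 0 < ε) (hlam : 0 < lam) (hdx : 0 < dx)
    (hsub : ε * |a| < lam) (p q : ℤ → ℝ)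
    (hp1 : Tendsto p atTop (nhds 0)) (hp2 : Tendsto p atBot (nhds 0))
    (hq1 : Tendsto q atTop (nhds 0)) (hq2 : Tendsto q atBot (nhds 0))
    (hsp : Summable (fun i => (Dx dx p i) ^ 2)) (hsq : Summable (fun i => (Dx dx q i) ^ 2))
    (habs : Summable (fun i => |q i * Dxx dx p i| + |p i * Dxx dx q i|)) :
    ∑' i : ℤ, dx * (-(ε ^ 2 * a * lam / 2) * dx * (q i * Dxx dx p i + p i * Dxx dx q i))
      ≤ lam ^ 3 / 2 * dx * (∑' i : ℤ, dx * (Dx dx p i) ^ 2)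
        + lam / 2 * ε ^ 2 * dx * (∑' i : ℤ, dx * (Dx dx q i) ^ 2) := by
  have s1 : Summable (fun i => q i * Dxx dx p i) :=
    Summable.of_norm_bounded habs (fun i => by
      rw [Real.norm_eq_abs]; linarith [abs_nonneg (p i * Dxx dx q i)])
  have s2 : Summable (fun i => p i * Dxx dx q i) :=
    Summable.of_norm_bounded habs (fun i => by
      rw [Real.norm_eq_abs]; linarith [abs_nonneg (q i * Dxx dx p i)])
  have hd : Summable (fun i => Dx dx p i * Dx dx q i) :=
    Summable.of_norm_bounded (hsp.add hsq) (fun i => by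
      rw [Real.norm_eq_abs, abs_le]
      constructor <;> nlinarith [sq_nonneg (Dx dx p i + Dx dx q i),
        sq_nonneg (Dx dx p i - Dx dx q i), sq_nonneg (Dx dx p i), sq_nonneg (Dx dx q i)])
  have hd' : Summable (fun i => Dx dx q i * Dx dx p i) := by simpa only [mul_comm] using hd
  have e1 := sum_by_parts_int dx hdx p q hp1 hp2 hq1 hq2 s1 hd
  have e2 := sum_by_parts_int dx hdx q p hq1 hq2 hp1 hp2 s2 hd'
  have e3 : ∑' i, Dx dx q i * Dx dx p i = ∑' i, Dx dx p i * Dx dx q i := by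
    simp only [mul_comm]
  rw [tsum_mul_left, tsum_mul_left, tsum_mul_left, tsum_mul_left, s1.tsum_add s2, e1, e2, e3]
  have main : ∑' i, (2 * ε ^ 2 * a) * (Dx dx p i * Dx dx q i)
      ≤ ∑' i, (lam ^ 2 * (Dx dx p i) ^ 2 + ε ^ 2 * (Dx dx q i) ^ 2) := by
    refine (hd.mul_left _).tsum_le_tsum (fun i => ?_) ((hsp.mul_left _).add (hsq.mul_left _))
    generalize Dx dx p i = x
    generalize Dx dx q i = y
    have hl : (ε * a) ^ 2 ≤ lam ^ 2 := by
      apply sq_le_sq'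
      · have := neg_abs_le a
        nlinarith
      · have := le_abs_self a
        nlinarith
    nlinarith [sq_nonneg (ε * a * x - ε * y), mul_le_mul_of_nonneg_right hl (sq_nonneg x)]
  rw [tsum_mul_left, (hsp.mul_left _).tsum_add (hsq.mul_left _), tsum_mul_left,
    tsum_mul_left] at main
  have hc : 0 ≤ lam * dx ^ 2 / 2 := by positivity
  have := mul_le_mul_of_nonneg_left main hc
  linarith

theorem discrete_residual_R4_estimate
    (ε lam a dx t : ℝ) (hε : 0 < ε) (hlam : 0 < lam) (hdx : 0 < dx) (ht : 0 < t)
    (hsub : ε * |a| < lam)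
    (u v ub vb : ℤ → ℝ → ℝ)
    -- decay of the differences as i → ±∞
    (hdecay_u : ∀ s ∈ Set.Icc (0:ℝ) t,
      Tendsto (fun i : ℤ => u i s - ub i s) atTop (nhds 0) ∧
      Tendsto (fun i : ℤ => u i s - ub i s) atBot (nhds 0))
    (hdecay_v : ∀ s ∈ Set.Icc (0:ℝ) t,
      Tendsto (fun i : ℤ => v i s - vb i s) atTop (nhds 0) ∧
      Tendsto (fun i : ℤ => v i s - vb i s) atBot (nhds 0))
    -- finiteness of the discrete L²(Q_t) norms of D_x(u−ū) and D_x(v−v̄)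
    (hsq_u : ∀ s ∈ Set.Icc (0:ℝ) t,
      Summable (fun i : ℤ => (Dx dx (fun j => u j s - ub j s) i) ^ 2))
    (hsq_v : ∀ s ∈ Set.Icc (0:ℝ) t,
      Summable (fun i : ℤ => (Dx dx (fun j => v j s - vb j s) i) ^ 2))
    (hL2_u : IntervalIntegrable
      (fun s => ∑' i : ℤ, dx * (Dx dx (fun j => u j s - ub j s) i) ^ 2)
      MeasureTheory.volume 0 t)
    (hL2_v : IntervalIntegrable
      (fun s => ∑' i : ℤ, dx * (Dx dx (fun j => v j s - vb j s) i) ^ 2)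
      MeasureTheory.volume 0 t)
    -- absolute convergence of the sums involved
    (habs : ∀ s ∈ Set.Icc (0:ℝ) t,
      Summable (fun i : ℤ => |(v i s - vb i s) * Dxx dx (fun j => u j s - ub j s) i|
        + |(u i s - ub i s) * Dxx dx (fun j => v j s - vb j s) i|))
    (hint_R4 : IntervalIntegrable
      (fun s => ∑' i : ℤ, dx * (-(ε ^ 2 * a * lam / 2) * dx
        * ((v i s - vb i s) * Dxx dx (fun j => u j s - ub j s) i
          + (u i s - ub i s) * Dxx dx (fun j => v j s - vb j s) i)))
      MeasureTheory.volume 0 t) :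
    (∫ s in (0:ℝ)..t, ∑' i : ℤ,
        dx * (-(ε ^ 2 * a * lam / 2) * dx
          * ((v i s - vb i s) * Dxx dx (fun j => u j s - ub j s) i
            + (u i s - ub i s) * Dxx dx (fun j => v j s - vb j s) i)))
      ≤ lam ^ 3 / 2 * dx * L2sq dx t (fun i s => Dx dx (fun j => u j s - ub j s) i)
        + lam / 2 * ε ^ 2 * dx
            * L2sq dx t (fun i s => Dx dx (fun j => v j s - vb j s) i) := by
  unfold L2sq
  rw [← intervalIntegral.integral_const_mul, ← intervalIntegral.integral_const_mul,
    ← intervalIntegral.integral_add (hL2_u.const_mul _) (hL2_v.const_mul _)]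
  refine intervalIntegral.integral_mono_on ht.le hint_R4
    ((hL2_u.const_mul _).add (hL2_v.const_mul _)) (fun s hs => ?_)
  exact pointwise_R4 ε lam a dx hε hlam hdx hsub (fun j => u j s - ub j s)
    (fun j => v j s - vb j s) (hdecay_u s hs).1 (hdecay_u s hs).2 (hdecay_v s hs).1
    (hdecay_v s hs).2 (hsq_u s hs) (hsq_v s hs) (habs s hs)
end

section
/- Let ε > 0, λ > 0, a ∈ ℝ satisfy the subcharacteristic condition λ > ε|a|, let Δx > 0, T > 0 and K > 0. Let (u_i, v_i)_{i∈ℤ} be a time-differentiable solution of the semi-discrete HLL scheme for the Jin–Xin system on [0,T), and let (ū_i, v̄_i)_{i∈ℤ} be a smooth solution of the semi-discrete limit scheme, with v̄_i differentiable in time. Assume: (i) the decay conditions: for each t, u_i(t) − ū_i(t) → 0 and v_i(t) − v̄_i(t) → 0 as i → ±∞, together with convergence of all the series appearing (in particular the telescoping sums of the discrete relative entropy fluxes vanish and the summation-by-parts identities for the residuals hold); (ii) ‖dv̄/dt‖²_{L²(Q_T)} ≤ K and ‖D_{xx} v̄‖²_{L²(Q_T)} ≤ K; (iii) φ(0) <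 ∞, where φ(t) = Σ_{i∈ℤ} Δx E_i(t). Then for all t ∈ [0,T), φ(t) ≤ φ(0) + K(1 + λ² Δx²/4) ε⁴; in particular there is a constant B > 0 depending only on λ, K and Δx such that φ(t) ≤ φ(0) + B ε⁴. -/
open Filter Topology

/- Total discrete relative entropy φ(t) = Σ_i Δx E_i(t). -/
noncomputable def discretePhi (ε lam a dx : ℝ) (u v ub vb : ℤ → ℝ → ℝ) (t : ℝ) : ℝ :=
  ∑' i : ℤ, dx * discreteRelEntropy ε lam a u v ub vb i t

lemma baire_bdd (T h G : ℝ) (hh : 0 < h) (N : ℝ → ℝ)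
    (hlsc : ∀ b : ℝ, IsClosed {t | t ∈ Set.Icc 0 T ∧ N t ≤ b})
    (hP : ∀ c d, 0 ≤ c → c ≤ d → d ≤ T → d - c ≤ h → (∃ B, ∀ x ∈ Set.Icc c d, N x ≤ B) →
      ∀ s ∈ Set.Icc c d, ∀ t ∈ Set.Icc c d, N t ≤ 2 * N s + G) :
    ∃ B, ∀ x ∈ Set.Icc 0 T, N x ≤ B := by
  set good : Set ℝ := {t | ∃ δ > 0, ∃ B, ∀ s ∈ Set.Icc 0 T, |s - t| < δ → N s ≤ B} with hgood
  have hopen : IsOpen good := by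
    rw [Metric.isOpen_iff]
    rintro t ⟨δ, hδ, B, hB⟩
    refine ⟨δ / 2, by positivity, fun t' ht' => ⟨δ / 2, by positivity, B, fun s hs hst => hB s hs ?_⟩⟩
    rw [Metric.mem_ball, Real.dist_eq] at ht'
    rw [abs_lt] at *
    constructor <;> linarith
  -- bounded on compact subsets of the good set
  have hcomp : ∀ c d, 0 ≤ c → d ≤ T → Set.Icc c d ⊆ good → ∃ B, ∀ x ∈ Set.Icc c d, N x ≤ B := by
    intro c d hc hd hsub
    refine IsCompact.induction_on (p := fun s => ∃ B, ∀ x ∈ s, x ∈ Set.Icc c d → N x ≤ B)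
      (isCompact_Icc (a := c) (b := d)) ⟨0, by simp⟩ ?_ ?_ ?_ |>.imp ?_
    · rintro s t hst ⟨B, hB⟩
      exact ⟨B, fun x hx => hB x (hst hx)⟩
    · rintro s t ⟨B, hB⟩ ⟨B', hB'⟩
      refine ⟨max B B', fun x hx hxi => ?_⟩
      rcases hx with hx | hx
      · exact (hB x hx hxi).trans (le_max_left _ _)
      · exact (hB' x hx hxi).trans (le_max_right _ _)
    · intro x hx
      obtain ⟨δ, hδ, B, hB⟩ := hsub hx
      refine ⟨Metric.ball x δ, mem_nhdsWithin_of_mem_nhds (Metric.ball_mem_nhds x hδ), B, ?_⟩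
      intro s hs hsi
      exact hB s ⟨hc.trans hsi.1, hsi.2.trans hd⟩ (by simpa [Real.dist_eq] using hs)
    · intro B hB x hx
      exact hB x hx hx
  by_cases hT : 0 ≤ T
  swap
  · exact ⟨0, fun x hx => absurd (hx.1.trans hx.2) hT⟩
  apply hcomp 0 T le_rfl le_rfl
  by_contra hne
  rw [Set.not_subset] at hne
  set F : Set ℝ := Set.Icc 0 T ∩ goodᶜ with hF
  have hFc : IsClosed F := isClosed_Icc.inter hopen.isClosed_compl
  obtain ⟨x0, hx0, hx0g⟩ := hne
  have : Nonempty F := ⟨⟨x0, hx0, hx0g⟩⟩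
  have : CompleteSpace F := hFc.completeSpace_coe
  obtain ⟨n, t0, ht0⟩ := nonempty_interior_of_iUnion_of_closed
    (f := fun n : ℕ => {x : F | N x ≤ n}) (fun n => by
      have : {x : F | N x ≤ n} = ((↑) : F → ℝ) ⁻¹' {t | t ∈ Set.Icc 0 T ∧ N t ≤ n} := by
        ext x
        simp only [Set.mem_ofPred_eq, Set.mem_preimage]
        exact ⟨fun h => ⟨x.2.1, h⟩, fun h => h.2⟩
      change IsClosed {x : F | N x ≤ n}
      rw [this]
      exact (hlsc n).preimage continuous_subtype_val) (by
      ext x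
      simp only [Set.mem_iUnion, Set.mem_ofPred_eq, Set.mem_univ, iff_true]
      exact exists_nat_ge _)
  rw [mem_interior_iff_mem_nhds, Metric.mem_nhds_iff] at ht0
  obtain ⟨δ, hδ, hball⟩ := ht0
  have hFn : ∀ t ∈ F, |t - t0| < δ → N t ≤ n := fun t ht htt =>
    hball (show (⟨t, ht⟩ : F) ∈ Metric.ball t0 δ by
      rw [Metric.mem_ball, Subtype.dist_eq, Real.dist_eq]; exact htt)
  apply t0.2.2
  refine ⟨min δ h, by positivity, max (n : ℝ) (2 * n + G), fun t ht htt => ?_⟩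
  have h1 : |t - t0| < δ := htt.trans_le (min_le_left _ _)
  have h2 : |t - t0| < h := htt.trans_le (min_le_right _ _)
  by_cases htF : t ∈ F
  · exact (hFn t htF h1).trans (le_max_left _ _)
  refine le_trans ?_ (le_max_right _ _)
  have ht0F := t0.2
  generalize (t0 : ℝ) = τ at *
  rw [abs_lt] at h1 h2
  rcases le_total τ t with hle | hle
  · obtain ⟨c, ⟨hcF, hct⟩, hcmax⟩ := ((isCompact_Icc (a := τ) (b := t)).inter_left hFc).exists_isGreatest
      ⟨τ, ht0F, le_rfl, hle⟩
    have hclt : c < t := lt_of_le_of_ne hct.2 (fun h => htF (h ▸ hcF))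
    have hg : ∀ x, c < x → x ≤ t → x ∈ good := by
      intro x hx hxt
      by_contra hxg
      exact absurd (hcmax ⟨⟨⟨hcF.1.1.trans hx.le, hxt.trans ht.2⟩, hxg⟩, hct.1.trans hx.le, hxt⟩)
        (not_le.2 hx)
    have hb : ∃ B, ∀ x ∈ Set.Icc c t, N x ≤ B := by
      refine ⟨max (N c) (2 * N t + G), fun x hx => ?_⟩
      rcases hx.1.eq_or_lt with rfl | hlt
      · exact le_max_left _ _
      refine le_trans ?_ (le_max_right _ _)
      have hx0 : 0 ≤ x := hcF.1.1.trans hx.1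
      exact hP x t hx0 hx.2 ht.2 (by linarith [hct.1]) (hcomp x t hx0 ht.2
        (fun z hz => hg z (hlt.trans_le hz.1) hz.2)) t ⟨hx.2, le_rfl⟩ x ⟨le_rfl, hx.2⟩
    have := hP c t hcF.1.1 hct.2 ht.2 (by linarith [hct.1]) hb c ⟨le_rfl, hct.2⟩ t ⟨hct.2, le_rfl⟩
    have := hFn c hcF (by rw [abs_lt]; constructor <;> linarith [hct.1, hct.2])
    linarith
  · obtain ⟨c, ⟨hcF, hct⟩, hcmax⟩ := ((isCompact_Icc (a := t) (b := τ)).inter_left hFc).exists_isLeast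
      ⟨τ, ht0F, hle, le_rfl⟩
    have hclt : t < c := lt_of_le_of_ne hct.1 (fun h => htF (h ▸ hcF))
    have hg : ∀ x, x < c → t ≤ x → x ∈ good := by
      intro x hx hxt
      by_contra hxg
      exact absurd (hcmax ⟨⟨⟨ht.1.trans hxt, hx.le.trans hcF.1.2⟩, hxg⟩, hxt, hx.le.trans hct.2⟩)
        (not_le.2 hx)
    have hb : ∃ B, ∀ x ∈ Set.Icc t c, N x ≤ B := by
      refine ⟨max (N c) (2 * N t + G), fun x hx => ?_⟩
      rcases hx.2.eq_or_lt with rfl | hlt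
      · exact le_max_left _ _
      refine le_trans ?_ (le_max_right _ _)
      have hx0 : x ≤ T := hx.2.trans hcF.1.2
      exact hP t x ht.1 hx.1 hx0 (by linarith [hct.2]) (hcomp t x ht.1 hx0
        (fun z hz => hg z (hz.2.trans_lt hlt) hz.1)) t ⟨le_rfl, hx.1⟩ x ⟨hx.1, le_rfl⟩
    have := hP t c ht.1 hct.1 hcF.1.2 (by linarith [hct.2]) hb c ⟨hct.1, le_rfl⟩ t ⟨le_rfl, hct.1⟩
    have := hFn c hcF (by rw [abs_lt]; constructor <;> linarith [hct.1, hct.2])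
    linarith

lemma l2_bdd {ι : Type*} (T C G : ℝ) (hT : 0 < T) (hC : 0 ≤ C) (hG : 0 ≤ G) (w w' : ι → ℝ → ℝ)
    (hd : ∀ i, ∀ t ∈ Set.Ico 0 T, HasDerivWithinAt (w i) (w' i t) (Set.Ico 0 T) t)
    (hs : ∀ t ∈ Set.Ico 0 T, Summable fun i => (w i t) ^ 2)
    (hb : ∀ t ∈ Set.Ico 0 T, ∀ S : Finset ι,
      ∑ i ∈ S, (w' i t) ^ 2 ≤ C * (∑' i, (w i t) ^ 2) + G) :
    ∃ B, 0 ≤ B ∧ ∀ t ∈ Set.Ico 0 T, ∑' i, (w i t) ^ 2 ≤ B := by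
  set N : ℝ → ℝ := fun t => ∑' i, (w i t) ^ 2 with hN
  have hN0 : ∀ t, 0 ≤ N t := fun t => tsum_nonneg fun i => sq_nonneg _
  set h : ℝ := 1 / (2 * (C + 1)) with hh
  have hhpos : 0 < h := by positivity
  have hhC : (C + 1) * h = 1 / 2 := by rw [hh]; field_simp
  have hcont : ∀ S : Finset ι, ContinuousOn (fun t => ∑ i ∈ S, (w i t) ^ 2) (Set.Ico 0 T) :=
    fun S => continuousOn_finsetSum _ fun i _ =>
      ContinuousOn.pow (fun t ht => (hd i t ht).continuousWithinAt) 2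
  -- the a priori estimate
  have hstep : ∀ c d, 0 ≤ c → d < T → d - c ≤ h → ∀ B, (∀ x ∈ Set.Icc c d, N x ≤ B) →
      ∀ s ∈ Set.Icc c d, ∀ t ∈ Set.Icc c d, N t ≤ N s + (B + G) / 2 := by
    intro c d hc hd' hcd B hB s hs' t ht
    have hsubI : Set.Icc c d ⊆ Set.Ico 0 T := fun x hx => ⟨hc.trans hx.1, hx.2.trans_lt hd'⟩
    have hBn : 0 ≤ B := (hN0 s).trans (hB s hs')
    refine Real.tsum_le_of_sum_le (fun i => sq_nonneg _) fun S => ?_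
    have hmv := Convex.norm_image_sub_le_of_norm_hasDerivWithin_le (𝕜 := ℝ)
      (f := fun t => ∑ i ∈ S, (w i t) ^ 2)
      (f' := fun t => ∑ i ∈ S, (2 * (w i t) * w' i t)) (s := Set.Icc c d) (x := s) (y := t)
      (C := (C + 1) * (B + G)) ?_ ?_ (convex_Icc c d) hs' ht
    · rw [Real.norm_eq_abs, Real.norm_eq_abs] at hmv
      have h1 : |t - s| ≤ h := by
        rw [abs_le]; constructor <;> linarith [hs'.1, hs'.2, ht.1, ht.2]
      have h2 : (C + 1) * (B + G) * |t - s| ≤ (C + 1) * (B + G) * h := by gcongr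
      have h3 : (C + 1) * (B + G) * h = (B + G) / 2 := by linear_combination (B + G) * hhC
      have h4 := (abs_le.1 hmv).2
      have h5 : ∑ i ∈ S, (w i s) ^ 2 ≤ N s := (hs s (hsubI hs')).sum_le_tsum S fun i _ => sq_nonneg _
      linarith
    · intro x hx
      refine HasDerivWithinAt.fun_sum fun i _ => ?_
      have := ((hd i x (hsubI hx)).mono hsubI).fun_pow 2
      simpa using this
    · intro x hx
      rw [Real.norm_eq_abs]
      calc |∑ i ∈ S, 2 * w i x * w' i x| ≤ ∑ i ∈ S, |2 * w i x * w' i x| :=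
            Finset.abs_sum_le_sum_abs _ _
        _ ≤ ∑ i ∈ S, ((w i x) ^ 2 + (w' i x) ^ 2) := by
            refine Finset.sum_le_sum fun i _ => ?_
            rw [abs_le]
            constructor <;> nlinarith [sq_nonneg (w i x + w' i x), sq_nonneg (w i x - w' i x)]
        _ = ∑ i ∈ S, (w i x) ^ 2 + ∑ i ∈ S, (w' i x) ^ 2 := Finset.sum_add_distrib
        _ ≤ N x + (C * N x + G) := add_le_add
            ((hs x (hsubI hx)).sum_le_tsum S fun i _ => sq_nonneg _) (hb x (hsubI hx) S)
        _ ≤ (C + 1) * (B + G) := by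
            have := hB x hx
            nlinarith [mul_nonneg hC hG, mul_le_mul_of_nonneg_left this hC]
  have hP : ∀ c d, 0 ≤ c → c ≤ d → d < T → d - c ≤ h → (∃ B, ∀ x ∈ Set.Icc c d, N x ≤ B) →
      ∀ s ∈ Set.Icc c d, ∀ t ∈ Set.Icc c d, N t ≤ 2 * N s + G := by
    rintro c d hc hcd hd' hcdh ⟨B, hB⟩ s hs' t ht
    have hbdd : BddAbove (N '' Set.Icc c d) := ⟨B, by rintro _ ⟨x, hx, rfl⟩; exact hB x hx⟩
    have hsup : ∀ x ∈ Set.Icc c d, N x ≤ sSup (N '' Set.Icc c d) :=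
      fun x hx => le_csSup hbdd ⟨x, hx, rfl⟩
    have h1 := hstep c d hc hd' hcdh _ hsup s hs'
    have h2 : sSup (N '' Set.Icc c d) ≤ N s + (sSup (N '' Set.Icc c d) + G) / 2 :=
      csSup_le ⟨_, s, hs', rfl⟩ (by rintro _ ⟨x, hx, rfl⟩; exact h1 x hx)
    have := hsup t ht
    linarith
  have hloc : ∀ T' < T, ∃ B, ∀ x ∈ Set.Icc 0 T', N x ≤ B := by
    intro T' hT'
    have hsubI : Set.Icc 0 T' ⊆ Set.Ico 0 T := fun x hx => ⟨hx.1, hx.2.trans_lt hT'⟩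
    refine baire_bdd T' h G hhpos N (fun b => ?_)
      (fun c d hc hcd hd' => hP c d hc hcd (hd'.trans_lt hT'))
    by_cases hb0 : 0 ≤ b
    swap
    · convert isClosed_empty
      ext t
      simp only [Set.mem_ofPred_eq, Set.mem_empty_iff_false, iff_false, not_and]
      intro _ h; exact hb0 ((hN0 t).trans h)
    have : {t | t ∈ Set.Icc 0 T' ∧ N t ≤ b} =
        ⋂ S : Finset ι, {t | t ∈ Set.Icc 0 T' ∧ ∑ i ∈ S, (w i t) ^ 2 ≤ b} := by
      ext t
      simp only [Set.mem_ofPred_eq, Set.mem_iInter]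
      constructor
      · rintro ⟨h1, h2⟩ S
        exact ⟨h1, ((hs t (hsubI h1)).sum_le_tsum S fun i _ => sq_nonneg _).trans h2⟩
      · intro h
        exact ⟨(h ∅).1, Real.tsum_le_of_sum_le (fun i => sq_nonneg _) fun S => (h S).2⟩
    rw [this]
    exact isClosed_iInter fun S =>
      ((hcont S).mono hsubI).preimage_isClosed_of_isClosed isClosed_Icc (isClosed_Iic (a := b))
  set c := max 0 (T - h) with hc
  have hc0 : 0 ≤ c := le_max_left _ _
  have hcT : c < T := max_lt hT (by linarith)
  have hcTh : T - h ≤ c := le_max_right _ _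
  obtain ⟨B, hB⟩ := hloc c hcT
  refine ⟨max B (2 * N c + G), le_max_of_le_right (by have := hN0 c; positivity), fun t ht => ?_⟩
  rcases le_total t c with h1 | h1
  · exact (hB t ⟨ht.1, h1⟩).trans (le_max_left _ _)
  · obtain ⟨B', hB'⟩ := hloc t ht.2
    exact (hP c t hc0 h1 ht.2 (by linarith [ht.2]) ⟨B', fun x hx => hB' x ⟨hc0.trans hx.1, hx.2⟩⟩
      c ⟨le_rfl, h1⟩ t ⟨h1, le_rfl⟩).trans (le_max_right _ _)

lemma sum_comp_inj_le {ι : Type*} (w : ι → ℝ) (hs : Summable fun i => (w i) ^ 2)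
    (e : ℤ → ι) (he : Function.Injective e) (S : Finset ℤ) :
    ∑ i ∈ S, (w (e i)) ^ 2 ≤ ∑' i, (w i) ^ 2 := by
  have := hs.sum_le_tsum (S.map ⟨e, he⟩) fun i _ => sq_nonneg _
  simpa using this

lemma stencil_bdd (T : ℝ) (hT : 0 < T) (c1 c2 c3 c4 c5 : ℝ) (w : ℤ → ℝ → ℝ)
    (hd : ∀ i, ∀ t ∈ Set.Ico 0 T, HasDerivWithinAt (w i)
      (c1 * w (i + 2) t + c2 * w (i + 1) t + c3 * w i t + c4 * w (i - 1) t + c5 * w (i - 2) t)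
      (Set.Ico 0 T) t)
    (hs : ∀ t ∈ Set.Ico 0 T, Summable fun i => (w i t) ^ 2) :
    ∃ B, 0 ≤ B ∧ ∀ t ∈ Set.Ico 0 T, ∑' i, (w i t) ^ 2 ≤ B := by
  refine l2_bdd T (5 * (c1 ^ 2 + c2 ^ 2 + c3 ^ 2 + c4 ^ 2 + c5 ^ 2)) 0 hT (by positivity) le_rfl w _
    hd hs fun t ht S => ?_
  have key : ∀ x1 x2 x3 x4 x5 : ℝ, (c1 * x1 + c2 * x2 + c3 * x3 + c4 * x4 + c5 * x5) ^ 2 ≤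
      (c1 ^ 2 + c2 ^ 2 + c3 ^ 2 + c4 ^ 2 + c5 ^ 2) * (x1 ^ 2 + x2 ^ 2 + x3 ^ 2 + x4 ^ 2 + x5 ^ 2) := by
    intro x1 x2 x3 x4 x5
    nlinarith [sq_nonneg (c1 * x2 - c2 * x1), sq_nonneg (c1 * x3 - c3 * x1),
      sq_nonneg (c1 * x4 - c4 * x1), sq_nonneg (c1 * x5 - c5 * x1), sq_nonneg (c2 * x3 - c3 * x2),
      sq_nonneg (c2 * x4 - c4 * x2), sq_nonneg (c2 * x5 - c5 * x2), sq_nonneg (c3 * x4 - c4 * x3),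
      sq_nonneg (c3 * x5 - c5 * x3), sq_nonneg (c4 * x5 - c5 * x4)]
  have h1 := sum_comp_inj_le (fun i => w i t) (hs t ht) (fun i => i + 2) (add_left_injective 2) S
  have h2 := sum_comp_inj_le (fun i => w i t) (hs t ht) (fun i => i + 1) (add_left_injective 1) S
  have h3 := sum_comp_inj_le (fun i => w i t) (hs t ht) (fun i => i) (fun _ _ h => h) S
  have h4 := sum_comp_inj_le (fun i => w i t) (hs t ht) (fun i => i - 1) (sub_left_injective) S
  have h5 := sum_comp_inj_le (fun i => w i t) (hs t ht) (fun i => i - 2) (sub_left_injective) S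
  refine (Finset.sum_le_sum fun i _ => key _ _ _ _ _).trans ?_
  rw [← Finset.mul_sum]
  simp only [Finset.sum_add_distrib]
  have hc : 0 ≤ c1 ^ 2 + c2 ^ 2 + c3 ^ 2 + c4 ^ 2 + c5 ^ 2 := by positivity
  refine (mul_le_mul_of_nonneg_left (add_le_add (add_le_add (add_le_add (add_le_add h1 h2) h3) h4) h5)
    hc).trans (le_of_eq ?_)
  ring

set_option maxHeartbeats 1600000 in
lemma pq_bdd (T : ℝ) (hT : 0 < T) (b1 b2 b3 b4 b5 G : ℝ) (hG : 0 ≤ G) (p q R : ℤ → ℝ → ℝ)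
    (hp : ∀ i, ∀ t ∈ Set.Ico 0 T, HasDerivAt (p i)
      (-(q (i + 1) t - q (i - 1) t) / b1
        + b2 * (p (i + 1) t - 2 * p i t + p (i - 1) t)) t)
    (hq : ∀ i, ∀ t ∈ Set.Ico 0 T, HasDerivAt (q i)
      (-b3 * (p (i + 1) t - p (i - 1) t)
        + b2 * (q (i + 1) t - 2 * q i t + q (i - 1) t)
        + (b4 * p i t - q i t) / b5 + R i t) t)
    (hR : ∀ t ∈ Set.Ico 0 T, ∀ S : Finset ℤ, ∑ i ∈ S, (R i t) ^ 2 ≤ G)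
    (hsp : ∀ t ∈ Set.Ico 0 T, Summable fun i => (p i t) ^ 2)
    (hsq : ∀ t ∈ Set.Ico 0 T, Summable fun i => (q i t) ^ 2) :
    ∃ B, 0 ≤ B ∧ ∀ t ∈ Set.Ico 0 T, ∀ i, (p i t) ^ 2 ≤ B ∧ (q i t) ^ 2 ≤ B := by
  have hsum : ∀ t ∈ Set.Ico 0 T, Summable fun i : ℤ ⊕ ℤ => (Sum.elim p q i t) ^ 2 := by
    intro t ht
    refine summable_of_sum_le (c := ∑' i, (p i t) ^ 2 + ∑' i, (q i t) ^ 2)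
      (fun i => sq_nonneg _) fun S => ?_
    rw [Finset.sum_sum_eq_sum_toLeft_add_sum_toRight]
    exact add_le_add ((hsp t ht).sum_le_tsum _ fun i _ => sq_nonneg _)
      ((hsq t ht).sum_le_tsum _ fun i _ => sq_nonneg _)
  set D := (1 / b1) ^ 2 + b2 ^ 2 + b3 ^ 2 + (b4 / b5) ^ 2 + (1 / b5) ^ 2 with hD
  have hD0 : 0 ≤ D := by positivity
  obtain ⟨B, hB0, hB⟩ := l2_bdd T (1000 * D) (10 * G) hT (by positivity) (by positivity)
    (Sum.elim p q)
    (Sum.elim (fun i t => -(q (i + 1) t - q (i - 1) t) / b1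
        + b2 * (p (i + 1) t - 2 * p i t + p (i - 1) t))
      (fun i t => -b3 * (p (i + 1) t - p (i - 1) t)
        + b2 * (q (i + 1) t - 2 * q i t + q (i - 1) t)
        + (b4 * p i t - q i t) / b5 + R i t)) (by
      rintro (i | i) t ht
      · exact (hp i t ht).hasDerivWithinAt
      · exact (hq i t ht).hasDerivWithinAt) hsum (by
      intro t ht S
      rw [Finset.sum_sum_eq_sum_toLeft_add_sum_toRight]
      simp only [Sum.elim_inl, Sum.elim_inr]
      set M := ∑' i : ℤ ⊕ ℤ, (Sum.elim p q i t) ^ 2 with hM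
      have hM0 : 0 ≤ M := tsum_nonneg fun i => sq_nonneg _
      have P : ∀ (k : ℤ) (S : Finset ℤ), ∑ i ∈ S, (p (i + k) t) ^ 2 ≤ M := fun k S =>
        sum_comp_inj_le (fun i => Sum.elim p q i t) (hsum t ht) (fun i => Sum.inl (i + k))
          (Sum.inl_injective.comp (add_left_injective k)) S
      have Q : ∀ (k : ℤ) (S : Finset ℤ), ∑ i ∈ S, (q (i + k) t) ^ 2 ≤ M := fun k S =>
        sum_comp_inj_le (fun i => Sum.elim p q i t) (hsum t ht) (fun i => Sum.inr (i + k))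
          (Sum.inr_injective.comp (add_left_injective k)) S
      have e1 : ∀ p0 p1 p2 q1 q2 : ℝ, (-(q1 - q2) / b1 + b2 * (p1 - 2 * p0 + p2)) ^ 2 ≤
          20 * D * (p0 ^ 2 + p1 ^ 2 + p2 ^ 2 + q1 ^ 2 + q2 ^ 2) := by
        intro p0 p1 p2 q1 q2
        have : (-(q1 - q2) / b1 + b2 * (p1 - 2 * p0 + p2)) ^ 2 ≤
          2 * ((1 / b1) ^ 2 * (q1 - q2) ^ 2) + 2 * (b2 ^ 2 * (p1 - 2 * p0 + p2) ^ 2) := by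
          have : -(q1 - q2) / b1 = -(1 / b1 * (q1 - q2)) := by ring
          rw [this]
          nlinarith [sq_nonneg (1 / b1 * (q1 - q2) + b2 * (p1 - 2 * p0 + p2))]
        have i1 : (1 / b1) ^ 2 ≤ D := by rw [hD]; linarith [sq_nonneg b2, sq_nonneg b3, sq_nonneg (b4 / b5), sq_nonneg (1 / b5)]
        have i2 : b2 ^ 2 ≤ D := by rw [hD]; linarith [sq_nonneg (1 / b1), sq_nonneg b3, sq_nonneg (b4 / b5), sq_nonneg (1 / b5)]
        have j1 := mul_le_mul_of_nonneg_right i1 (sq_nonneg (q1 - q2))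
        have j2 := mul_le_mul_of_nonneg_right i2 (sq_nonneg (p1 - 2 * p0 + p2))
        have k1 : (q1 - q2) ^ 2 ≤ 2 * (q1 ^ 2 + q2 ^ 2) := by nlinarith [sq_nonneg (q1 + q2)]
        have k2 : (p1 - 2 * p0 + p2) ^ 2 ≤ 10 * (p0 ^ 2 + p1 ^ 2 + p2 ^ 2) := by
          nlinarith [sq_nonneg (p1 + p0), sq_nonneg (p2 + p0), sq_nonneg (p1 - p2)]
        have l1 := mul_le_mul_of_nonneg_left k1 hD0
        have l2 := mul_le_mul_of_nonneg_left k2 hD0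
        have l3 : 0 ≤ D * (q1 ^ 2 + q2 ^ 2) := by positivity
        linarith
      have e2 : ∀ p0 p1 p2 q0 q1 q2 r : ℝ, (-b3 * (p1 - p2) + b2 * (q1 - 2 * q0 + q2)
          + (b4 * p0 - q0) / b5 + r) ^ 2 ≤
          5 * (20 * D * (p0 ^ 2 + p1 ^ 2 + p2 ^ 2 + q0 ^ 2 + q1 ^ 2 + q2 ^ 2)) + 5 * r ^ 2 := by
        intro p0 p1 p2 q0 q1 q2 r
        have : (-b3 * (p1 - p2) + b2 * (q1 - 2 * q0 + q2)
          + (b4 * p0 - q0) / b5 + r) ^ 2 ≤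
          5 * (b3 ^ 2 * (p1 - p2) ^ 2) + 5 * (b2 ^ 2 * (q1 - 2 * q0 + q2) ^ 2)
           + 5 * ((b4 / b5) ^ 2 * p0 ^ 2) + 5 * ((1 / b5) ^ 2 * q0 ^ 2) + 5 * r ^ 2 := by
          have : (b4 * p0 - q0) / b5 = b4 / b5 * p0 - 1 / b5 * q0 := by ring
          rw [this]
          have gen : ∀ x y z w s : ℝ, (-x + y + (z - w) + s) ^ 2 ≤
              5 * x ^ 2 + 5 * y ^ 2 + 5 * z ^ 2 + 5 * w ^ 2 + 5 * s ^ 2 := by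
            intro x y z w s
            nlinarith [sq_nonneg (x + y), sq_nonneg (x + z), sq_nonneg (x - w), sq_nonneg (x + s),
              sq_nonneg (y - z), sq_nonneg (y + w), sq_nonneg (y - s), sq_nonneg (z + w),
              sq_nonneg (z - s), sq_nonneg (w + s)]
          have := gen (b3 * (p1 - p2)) (b2 * (q1 - 2 * q0 + q2)) (b4 / b5 * p0) (1 / b5 * q0) r
          simp only [mul_pow] at this ⊢
          rw [neg_mul]
          exact this
        have i1 : b3 ^ 2 ≤ D := by rw [hD]; linarith [sq_nonneg b2, sq_nonneg (1 / b1), sq_nonneg (b4 / b5), sq_nonneg (1 / b5)]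
        have i2 : b2 ^ 2 ≤ D := by rw [hD]; linarith [sq_nonneg (1 / b1), sq_nonneg b3, sq_nonneg (b4 / b5), sq_nonneg (1 / b5)]
        have i3 : (b4 / b5) ^ 2 ≤ D := by rw [hD]; linarith [sq_nonneg (1 / b1), sq_nonneg b3, sq_nonneg b2, sq_nonneg (1 / b5)]
        have i4 : (1 / b5) ^ 2 ≤ D := by rw [hD]; linarith [sq_nonneg (1 / b1), sq_nonneg b3, sq_nonneg b2, sq_nonneg (b4 / b5)]
        have j1 := mul_le_mul_of_nonneg_right i1 (sq_nonneg (p1 - p2))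
        have j2 := mul_le_mul_of_nonneg_right i2 (sq_nonneg (q1 - 2 * q0 + q2))
        have j3 := mul_le_mul_of_nonneg_right i3 (sq_nonneg p0)
        have j4 := mul_le_mul_of_nonneg_right i4 (sq_nonneg q0)
        have k1 : (p1 - p2) ^ 2 ≤ 2 * (p1 ^ 2 + p2 ^ 2) := by nlinarith [sq_nonneg (p1 + p2)]
        have k2 : (q1 - 2 * q0 + q2) ^ 2 ≤ 10 * (q0 ^ 2 + q1 ^ 2 + q2 ^ 2) := by
          nlinarith [sq_nonneg (q1 + q0), sq_nonneg (q2 + q0), sq_nonneg (q1 - q2)]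
        have l1 := mul_le_mul_of_nonneg_left k1 hD0
        have l2 := mul_le_mul_of_nonneg_left k2 hD0
        have l3 : 0 ≤ D * (q0 ^ 2 + q1 ^ 2 + q2 ^ 2) := by positivity
        have l4 : 0 ≤ D * (p0 ^ 2) := by positivity
        have l5 : 0 ≤ D * (p1 ^ 2 + p2 ^ 2) := by positivity
        have l6 : 0 ≤ D * (q1 ^ 2 + q2 ^ 2) := by positivity
        linarith
      have s1 : ∑ i ∈ S.toLeft, (-(q (i + 1) t - q (i - 1) t) / b1
        + b2 * (p (i + 1) t - 2 * p i t + p (i - 1) t)) ^ 2 ≤ 20 * D * (M + M + M + M + M) := by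
        refine (Finset.sum_le_sum fun i _ => e1 _ _ _ _ _).trans ?_
        rw [← Finset.mul_sum]
        simp only [Finset.sum_add_distrib]
        refine mul_le_mul_of_nonneg_left ?_ (by positivity)
        exact add_le_add (add_le_add (add_le_add (add_le_add (by simpa using P 0 S.toLeft)
          (P 1 _)) (P (-1) _)) (Q 1 _)) (Q (-1) _)
      have s2 : ∑ i ∈ S.toRight, (-b3 * (p (i + 1) t - p (i - 1) t)
        + b2 * (q (i + 1) t - 2 * q i t + q (i - 1) t)
        + (b4 * p i t - q i t) / b5 + R i t) ^ 2 ≤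
          5 * (20 * D * (M + M + M + M + M + M)) + 5 * G := by
        refine (Finset.sum_le_sum fun i _ => e2 _ _ _ _ _ _ _).trans ?_
        rw [Finset.sum_add_distrib, ← Finset.mul_sum, ← Finset.mul_sum, ← Finset.mul_sum]
        simp only [Finset.sum_add_distrib]
        refine add_le_add ?_ (mul_le_mul_of_nonneg_left (hR t ht _) (by norm_num))
        refine mul_le_mul_of_nonneg_left ?_ (by norm_num)
        refine mul_le_mul_of_nonneg_left ?_ (by positivity)
        exact add_le_add (add_le_add (add_le_add (add_le_add (add_le_add
          (by simpa using P 0 S.toRight)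
          (P 1 _)) (P (-1) _)) (by simpa using Q 0 S.toRight)) (Q 1 _)) (Q (-1) _)
      have : 0 ≤ D * M := by positivity
      linarith)
  refine ⟨B, hB0, fun t ht i => ⟨?_, ?_⟩⟩
  · exact ((hsum t ht).le_tsum (Sum.inl i) fun j _ => sq_nonneg _).trans (hB t ht)
  · exact ((hsum t ht).le_tsum (Sum.inr i) fun j _ => sq_nonneg _).trans (hB t ht)

lemma integral_partial_le (T dx K B : ℝ) (hdx : 0 < dx) (y : ℤ → ℝ → ℝ)
    (hc : ∀ i, ContinuousOn (y i) (Set.Ico 0 T))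
    (hs : ∀ t ∈ Set.Ico 0 T, Summable fun i => (y i t) ^ 2)
    (hB : ∀ t ∈ Set.Ico 0 T, ∑' i, (y i t) ^ 2 ≤ B)
    (hK : (∫ s in (0:ℝ)..T, ∑' i : ℤ, dx * (y i s) ^ 2) ≤ K) (t : ℝ) (ht : t ∈ Set.Ico 0 T)
    (S : Finset ℤ) : (∫ s in (0:ℝ)..t, ∑ i ∈ S, dx * (y i s) ^ 2) ≤ K := by
  have hT : 0 ≤ T := ht.1.trans ht.2.le
  have hcS : ∀ S : Finset ℤ, ContinuousOn (fun s => ∑ i ∈ S, dx * (y i s) ^ 2) (Set.Ico 0 T) :=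
    fun S => continuousOn_finsetSum _ fun i _ => continuousOn_const.mul ((hc i).pow 2)
  have hI : IntervalIntegrable (fun s => ∑' i : ℤ, dx * (y i s) ^ 2) MeasureTheory.volume 0 T := by
    rw [intervalIntegrable_iff_integrableOn_Ico_of_le hT]
    refine MeasureTheory.IntegrableOn.of_bound (C := dx * B) (by simp) ?_ ?_
    · refine aestronglyMeasurable_of_tendsto_ae atTop
        (f := fun n : ℕ => fun s => ∑ i ∈ Finset.Icc (-(n : ℤ)) n, dx * (y i s) ^ 2)
        (fun n => (hcS _).aestronglyMeasurable measurableSet_Ico) ?_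
      refine (MeasureTheory.ae_restrict_iff' measurableSet_Ico).2 (Eventually.of_forall fun s hs' => ?_)
      exact ((hs s hs').mul_left dx).hasSum.comp (Finset.tendsto_Icc_neg_atTop_atTop.comp tendsto_natCast_atTop_atTop)
    · refine (MeasureTheory.ae_restrict_iff' measurableSet_Ico).2 (Eventually.of_forall fun s hs' => ?_)
      rw [Real.norm_eq_abs, abs_of_nonneg (tsum_nonneg fun i => by positivity), tsum_mul_left]
      exact mul_le_mul_of_nonneg_left (hB s hs') hdx.le
  have hsub : Set.uIcc 0 t ⊆ Set.uIcc 0 T := by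
    rw [Set.uIcc_of_le ht.1, Set.uIcc_of_le hT]; exact Set.Icc_subset_Icc le_rfl ht.2.le
  refine le_trans ?_ hK
  refine le_trans (b := ∫ s in (0:ℝ)..t, ∑' i : ℤ, dx * (y i s) ^ 2) ?_ ?_
  · refine intervalIntegral.integral_mono_on ht.1 ?_ (hI.mono_set hsub) fun s hs' => ?_
    · refine ((hcS S).mono ?_).intervalIntegrable
      rw [Set.uIcc_of_le ht.1]; exact fun x hx => ⟨hx.1, hx.2.trans_lt ht.2⟩
    · exact ((hs s ⟨hs'.1, hs'.2.trans_lt ht.2⟩).mul_left dx).sum_le_tsum S fun i _ => by positivity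
  · exact intervalIntegral.integral_mono_interval le_rfl ht.1 ht.2.le
      (Eventually.of_forall fun s => tsum_nonneg fun i => by positivity) hI

lemma tele_sum (F : ℤ → ℝ) (n : ℕ) :
    ∑ i ∈ Finset.Icc (-(n : ℤ)) n, (F i - F (i - 1)) = F n - F (-(n : ℤ) - 1) := by
  induction n with
  | zero => simp
  | succ n ih =>
    have : Finset.Icc (-((n + 1 : ℕ) : ℤ)) ((n + 1 : ℕ) : ℤ) =
        insert (-((n : ℤ) + 1)) (insert ((n : ℤ) + 1) (Finset.Icc (-(n : ℤ)) n)) := by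
      ext x; simp only [Finset.mem_Icc, Finset.mem_insert]; push_cast; omega
    rw [this, Finset.sum_insert, Finset.sum_insert, ih]
    · push_cast
      have e1 : (n : ℤ) + 1 - 1 = n := by ring
      have e2 : -(n : ℤ) - 1 = -((n : ℤ) + 1) := by ring
      rw [e1, e2]; ring
    · simp
    · simp only [Finset.mem_Icc, Finset.mem_insert]; omega

/-- Modified numerical flux as a function of `(p_i, p_{i+1}, q_i, q_{i+1})`. -/
noncomputable def modFlux (ε lam a : ℝ) (x : ℝ × ℝ × ℝ × ℝ) : ℝ :=
  -(ε ^ 2 * a / 2) * x.2.2.1 * x.2.2.2 - lam ^ 2 * a / 2 * x.1 * x.2.1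
    + lam ^ 2 / 2 * (x.1 * x.2.2.2 + x.2.1 * x.2.2.1)
    - lam / 2 * (lam ^ 2 * x.1 * (x.2.1 - x.1)
      - ε ^ 2 * a * (x.2.2.1 * (x.2.1 - x.1) + x.1 * (x.2.2.2 - x.2.2.1))
      + ε ^ 2 * x.2.2.1 * (x.2.2.2 - x.2.2.1))

lemma modFlux_cont (ε lam a : ℝ) : Continuous (modFlux ε lam a) := by
  unfold modFlux; fun_prop

lemma entropy_ineq (ε lam a dx : ℝ) (hε : 0 < ε) (hlam : 0 < lam) (hdx : 0 < dx)
    (hsub : ε * |a| < lam) (p0 p1 pm q0 q1 qm y z : ℝ) :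
    dx * ((lam ^ 2 * p0 - ε ^ 2 * a * q0) *
        (-(q1 - qm) / (2 * dx) + lam / (2 * dx) * (p1 - 2 * p0 + pm))
      + (ε ^ 2 * q0 - ε ^ 2 * a * p0) *
        (-(lam ^ 2 / (2 * ε ^ 2 * dx)) * (p1 - pm) + lam / (2 * dx) * (q1 - 2 * q0 + qm)
          + (a * p0 - q0) / ε ^ 2 + (lam * dx / 2 * z - y)))
    ≤ -(modFlux ε lam a (p0, p1, q0, q1) - modFlux ε lam a (pm, p0, qm, q0))
      + (ε ^ 4 / 2 * (dx * y ^ 2) + ε ^ 4 / 2 * (lam ^ 2 * dx ^ 2 / 4) * (dx * z ^ 2)) := by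
  have hla : 0 ≤ lam ^ 2 - ε ^ 2 * a ^ 2 := by
    have : (ε * |a|) ^ 2 ≤ lam ^ 2 := by gcongr
    rw [mul_pow, sq_abs] at this; linarith
  have hvis : 0 ≤ lam / 2 * ((ε * (q0 - qm) - ε * a * (p0 - pm)) ^ 2
      + (lam ^ 2 - ε ^ 2 * a ^ 2) * (p0 - pm) ^ 2) := by positivity
  have hrel : 0 ≤ dx * ((q0 - a * p0) - ε ^ 2 / 2 * (lam * dx / 2 * z - y)) ^ 2 := by positivity
  have hR : 0 ≤ dx * (ε ^ 4 / 4 * (lam * dx / 2 * z + y) ^ 2) := by positivity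
  have key : dx * ((lam ^ 2 * p0 - ε ^ 2 * a * q0) *
        (-(q1 - qm) / (2 * dx) + lam / (2 * dx) * (p1 - 2 * p0 + pm))
      + (ε ^ 2 * q0 - ε ^ 2 * a * p0) *
        (-(lam ^ 2 / (2 * ε ^ 2 * dx)) * (p1 - pm) + lam / (2 * dx) * (q1 - 2 * q0 + qm)
          + (a * p0 - q0) / ε ^ 2 + (lam * dx / 2 * z - y)))
    = (lam ^ 2 * p0 - ε ^ 2 * a * q0) *
        (-(q1 - qm) / 2 + lam / 2 * (p1 - 2 * p0 + pm))
      + (q0 - a * p0) *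
        (-(lam ^ 2 / 2) * (p1 - pm) + ε ^ 2 * lam / 2 * (q1 - 2 * q0 + qm)
          + dx * (a * p0 - q0) + ε ^ 2 * dx * (lam * dx / 2 * z - y)) := by
    field_simp
  rw [key]
  unfold modFlux
  dsimp only
  linarith

lemma core (ε lam a dx T K : ℝ) (hε : 0 < ε) (hlam : 0 < lam) (hdx : 0 < dx)
    (hK : 0 < K) (hsub : ε * |a| < lam)
    (p q y z : ℤ → ℝ → ℝ) (B : ℝ)
    (hp : ∀ i, ∀ t ∈ Set.Ico 0 T, HasDerivAt (p i)
      (-(q (i + 1) t - q (i - 1) t) / (2 * dx)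
        + lam / (2 * dx) * (p (i + 1) t - 2 * p i t + p (i - 1) t)) t)
    (hq : ∀ i, ∀ t ∈ Set.Ico 0 T, HasDerivAt (q i)
      (-(lam ^ 2 / (2 * ε ^ 2 * dx)) * (p (i + 1) t - p (i - 1) t)
        + lam / (2 * dx) * (q (i + 1) t - 2 * q i t + q (i - 1) t)
        + (a * p i t - q i t) / ε ^ 2 + (lam * dx / 2 * z i t - y i t)) t)
    (hy : ∀ i, ContinuousOn (y i) (Set.Ico 0 T))
    (hz : ∀ i, ContinuousOn (z i) (Set.Ico 0 T))
    (hB : ∀ t ∈ Set.Ico 0 T, ∀ i, (p i t) ^ 2 ≤ B ∧ (q i t) ^ 2 ≤ B)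
    (hpd : ∀ t ∈ Set.Ico (0:ℝ) T, Tendsto (fun i => p i t) atTop (𝓝 0) ∧
      Tendsto (fun i => p i t) atBot (𝓝 0))
    (hqd : ∀ t ∈ Set.Ico (0:ℝ) T, Tendsto (fun i => q i t) atTop (𝓝 0) ∧
      Tendsto (fun i => q i t) atBot (𝓝 0))
    (hyK : ∀ t ∈ Set.Ico 0 T, ∀ S : Finset ℤ, (∫ s in (0:ℝ)..t, ∑ i ∈ S, dx * (y i s) ^ 2) ≤ K)
    (hzK : ∀ t ∈ Set.Ico 0 T, ∀ S : Finset ℤ, (∫ s in (0:ℝ)..t, ∑ i ∈ S, dx * (z i s) ^ 2) ≤ K)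
    (E : ℤ → ℝ → ℝ) (hE : E = fun i t => lam ^ 2 / 2 * (p i t) ^ 2 + ε ^ 2 / 2 * (q i t) ^ 2
      - ε ^ 2 * a * (p i t) * (q i t))
    (hEs : ∀ t ∈ Set.Ico 0 T, Summable fun i => E i t) (t : ℝ) (ht : t ∈ Set.Ico 0 T) :
    ∑' i, dx * E i t ≤ ∑' i, dx * E i 0 + K * (1 + lam ^ 2 * dx ^ 2 / 4) * ε ^ 4 := by
  have hsubI : Set.Icc 0 t ⊆ Set.Ico 0 T := fun x hx => ⟨hx.1, hx.2.trans_lt ht.2⟩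
  have hpc : ∀ i, ContinuousOn (p i) (Set.Icc 0 t) :=
    fun i s hs => (hp i s (hsubI hs)).continuousAt.continuousWithinAt
  have hqc : ∀ i, ContinuousOn (q i) (Set.Icc 0 t) :=
    fun i s hs => (hq i s (hsubI hs)).continuousAt.continuousWithinAt
  have hyc : ∀ i, ContinuousOn (y i) (Set.Icc 0 t) := fun i => (hy i).mono hsubI
  have hzc : ∀ i, ContinuousOn (z i) (Set.Icc 0 t) := fun i => (hz i).mono hsubI
  set F : ℤ → ℝ → ℝ := fun i s => modFlux ε lam a (p i s, p (i + 1) s, q i s, q (i + 1) s) with hF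
  have hFc : ∀ i, ContinuousOn (F i) (Set.Icc 0 t) := fun i =>
    (modFlux_cont ε lam a).comp_continuousOn
      ((hpc i).prodMk ((hpc (i + 1)).prodMk ((hqc i).prodMk (hqc (i + 1)))))
  set dE : ℤ → ℝ → ℝ := fun i s => dx * ((lam ^ 2 * p i s - ε ^ 2 * a * q i s) *
        (-(q (i + 1) s - q (i - 1) s) / (2 * dx)
          + lam / (2 * dx) * (p (i + 1) s - 2 * p i s + p (i - 1) s))
      + (ε ^ 2 * q i s - ε ^ 2 * a * p i s) *
        (-(lam ^ 2 / (2 * ε ^ 2 * dx)) * (p (i + 1) s - p (i - 1) s)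
          + lam / (2 * dx) * (q (i + 1) s - 2 * q i s + q (i - 1) s)
          + (a * p i s - q i s) / ε ^ 2 + (lam * dx / 2 * z i s - y i s))) with hdE
  have hdEc : ∀ i, ContinuousOn (dE i) (Set.Icc 0 t) := by
    intro i
    have h1 := hpc i
    have h2 := hpc (i + 1)
    have h3 := hpc (i - 1)
    have h4 := hqc i
    have h5 := hqc (i + 1)
    have h6 := hqc (i - 1)
    have h7 := hyc i
    have h8 := hzc i
    simp only [hdE, div_eq_mul_inv]
    fun_prop
  have hEd : ∀ i, ∀ s ∈ Set.Icc 0 t, HasDerivAt (fun s => dx * E i s) (dE i s) s := by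
    intro i s hs
    have h1 := hp i s (hsubI hs)
    have h2 := hq i s (hsubI hs)
    rw [hE]
    refine ((((h1.fun_pow 2).const_mul (lam ^ 2 / 2)).add
      ((h2.fun_pow 2).const_mul (ε ^ 2 / 2))).sub
      (((h1.const_mul (ε ^ 2 * a)).mul h2))).const_mul dx |>.congr_deriv ?_
    simp only [hdE]
    push_cast
    ring
  -- boundary terms tend to zero
  obtain ⟨M, hM⟩ : ∃ M, ∀ i, ∀ s ∈ Set.Icc 0 t, ‖F i s‖ ≤ M := by
    set r := Real.sqrt B
    obtain ⟨M, hM⟩ := (isCompact_Icc (a := ((-r, -r, -r, -r) : ℝ × ℝ × ℝ × ℝ))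
      (b := (r, r, r, r))).exists_bound_of_continuousOn (modFlux_cont ε lam a).continuousOn
    refine ⟨M, fun i s hs => hM _ ?_⟩
    have A := fun j => abs_le.1 (Real.abs_le_sqrt (hB s (hsubI hs) j).1)
    have A' := fun j => abs_le.1 (Real.abs_le_sqrt (hB s (hsubI hs) j).2)
    exact ⟨⟨(A _).1, (A _).1, (A' _).1, (A' _).1⟩, ⟨(A _).2, (A _).2, (A' _).2, (A' _).2⟩⟩
  have hF0 : modFlux ε lam a (0, 0, 0, 0) = 0 := by simp [modFlux]
  have hlim : ∀ k : ℕ → ℤ, (Tendsto k atTop atTop ∨ Tendsto k atTop atBot) →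
      Tendsto (fun n => ∫ s in (0:ℝ)..t, F (k n) s) atTop (𝓝 0) := by
    intro k hk
    have := intervalIntegral.tendsto_integral_filter_of_dominated_convergence (a := 0) (b := t)
      (μ := MeasureTheory.volume) (l := atTop) (F := fun n s => F (k n) s) (f := fun _ => (0:ℝ))
      (fun _ => M) ?_ ?_ ?_ ?_
    · simpa using this
    · refine Eventually.of_forall fun n => ?_
      rw [Set.uIoc_of_le ht.1]
      exact ((hFc (k n)).mono Set.Ioc_subset_Icc_self).aestronglyMeasurable measurableSet_Ioc
    · refine Eventually.of_forall fun n => Eventually.of_forall fun s hs => ?_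
      rw [Set.uIoc_of_le ht.1] at hs
      exact hM _ s (Set.Ioc_subset_Icc_self hs)
    · exact intervalIntegrable_const
    · refine Eventually.of_forall fun s hs => ?_
      rw [Set.uIoc_of_le ht.1] at hs
      have hs' := hsubI (Set.Ioc_subset_Icc_self hs)
      have hk1 : (Tendsto (fun n => k n + 1) atTop atTop ∧ Tendsto k atTop atTop) ∨
          (Tendsto (fun n => k n + 1) atTop atBot ∧ Tendsto k atTop atBot) := by
        rcases hk with hk | hk
        · exact Or.inl ⟨tendsto_atTop_add_const_right _ _ hk, hk⟩
        · exact Or.inr ⟨tendsto_atBot_add_const_right _ _ hk, hk⟩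
      have hten : ∀ w : ℤ → ℝ, (Tendsto w atTop (𝓝 0) ∧ Tendsto w atBot (𝓝 0)) →
          Tendsto (fun n => w (k n)) atTop (𝓝 0) ∧ Tendsto (fun n => w (k n + 1)) atTop (𝓝 0) := by
        intro w hw
        rcases hk1 with h | h
        · exact ⟨hw.1.comp h.2, hw.1.comp h.1⟩
        · exact ⟨hw.2.comp h.2, hw.2.comp h.1⟩
      have t1 := hten _ (hpd s hs')
      have t2 := hten _ (hqd s hs')
      have := ((modFlux_cont ε lam a).tendsto (0, 0, 0, 0)).comp
        (t1.1.prodMk_nhds (t1.2.prodMk_nhds (t2.1.prodMk_nhds t2.2)))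
      rw [hF0] at this
      exact this
  have hInt : ∀ f : ℝ → ℝ, ContinuousOn f (Set.Icc 0 t) →
      IntervalIntegrable f MeasureTheory.volume 0 t := fun f hf => by
    apply ContinuousOn.intervalIntegrable; rwa [Set.uIcc_of_le ht.1]
  set X := ε ^ 4 / 2 * K + ε ^ 4 / 2 * (lam ^ 2 * dx ^ 2 / 4) * K with hX
  have hmain : ∀ n : ℕ, ∑ i ∈ Finset.Icc (-(n : ℤ)) n, dx * E i t ≤
      ∑ i ∈ Finset.Icc (-(n : ℤ)) n, dx * E i 0
      + (-(∫ s in (0:ℝ)..t, F n s) + ∫ s in (0:ℝ)..t, F (-(n : ℤ) - 1) s) + X := by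
    intro n
    set S := Finset.Icc (-(n : ℤ)) n with hS
    have hcy : ContinuousOn (fun s => ∑ i ∈ S, dx * (y i s) ^ 2) (Set.Icc 0 t) :=
      continuousOn_finsetSum _ fun i _ => continuousOn_const.mul ((hyc i).pow 2)
    have hcz : ContinuousOn (fun s => ∑ i ∈ S, dx * (z i s) ^ 2) (Set.Icc 0 t) :=
      continuousOn_finsetSum _ fun i _ => continuousOn_const.mul ((hzc i).pow 2)
    have hdS : ContinuousOn (fun s => ∑ i ∈ S, dE i s) (Set.Icc 0 t) :=
      continuousOn_finsetSum _ fun i _ => hdEc i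
    have hftc := intervalIntegral.integral_eq_sub_of_hasDerivAt (a := 0) (b := t)
      (f := fun s => ∑ i ∈ S, dx * E i s) (f' := fun s => ∑ i ∈ S, dE i s) (fun s hs => by
        rw [Set.uIcc_of_le ht.1] at hs
        exact HasDerivAt.fun_sum fun i _ => hEd i s hs) (hInt _ hdS)
    have hle : (∫ s in (0:ℝ)..t, ∑ i ∈ S, dE i s) ≤ ∫ s in (0:ℝ)..t,
        ((-(F n s) + F (-(n : ℤ) - 1) s) + (ε ^ 4 / 2 * (∑ i ∈ S, dx * (y i s) ^ 2)
          + ε ^ 4 / 2 * (lam ^ 2 * dx ^ 2 / 4) * (∑ i ∈ S, dx * (z i s) ^ 2))) := by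
      refine intervalIntegral.integral_mono_on ht.1 (hInt _ hdS) (hInt _ ?_) fun s hs => ?_
      · exact ((hFc _).neg.add (hFc _)).add
          ((continuousOn_const.mul hcy).add (continuousOn_const.mul hcz))
      · have h1 : ∀ i ∈ S, dE i s ≤ -(F i s - F (i - 1) s) + (ε ^ 4 / 2 * (dx * (y i s) ^ 2)
            + ε ^ 4 / 2 * (lam ^ 2 * dx ^ 2 / 4) * (dx * (z i s) ^ 2)) := by
          intro i _
          have := entropy_ineq ε lam a dx hε hlam hdx hsub (p i s) (p (i + 1) s) (p (i - 1) s)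
            (q i s) (q (i + 1) s) (q (i - 1) s) (y i s) (z i s)
          simp only [hF, hdE, sub_add_cancel]
          exact this
        refine (Finset.sum_le_sum h1).trans (le_of_eq ?_)
        rw [Finset.sum_add_distrib, Finset.sum_add_distrib, Finset.sum_neg_distrib,
          tele_sum (fun i => F i s) n, Finset.mul_sum, Finset.mul_sum]
        ring
    rw [hftc, intervalIntegral.integral_add, intervalIntegral.integral_add,
      intervalIntegral.integral_add, intervalIntegral.integral_const_mul,
      intervalIntegral.integral_const_mul, intervalIntegral.integral_neg] at hle
    · have k1 := mul_le_mul_of_nonneg_left (hyK t ht S) (by positivity : 0 ≤ ε ^ 4 / 2)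
      have k2 := mul_le_mul_of_nonneg_left (hzK t ht S)
        (by positivity : 0 ≤ ε ^ 4 / 2 * (lam ^ 2 * dx ^ 2 / 4))
      linarith
    · exact hInt _ (continuousOn_const.mul hcy)
    · exact hInt _ (continuousOn_const.mul hcz)
    · exact hInt _ (hFc _).neg
    · exact hInt _ (hFc _)
    · exact hInt _ ((hFc _).neg.add (hFc _))
    · exact hInt _ ((continuousOn_const.mul hcy).add (continuousOn_const.mul hcz))
  have h0 : (0:ℝ) ∈ Set.Ico 0 T := ⟨le_rfl, ht.1.trans_lt ht.2⟩
  have hI : Tendsto (fun n : ℕ => Finset.Icc (-(n : ℤ)) n) atTop atTop := Finset.tendsto_Icc_neg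
  have L1 := ((hEs t ht).mul_left dx).hasSum.comp hI
  have L2 := ((hEs 0 h0).mul_left dx).hasSum.comp hI
  have hn : Tendsto (fun n : ℕ => (n : ℤ)) atTop atTop := tendsto_natCast_atTop_atTop
  have L3 := hlim (fun n => (n : ℤ)) (Or.inl hn)
  have L4 := hlim (fun n => -(n : ℤ) - 1) (Or.inr (by
    have := tendsto_atBot_add_const_right atTop (-1 : ℤ) (tendsto_neg_atTop_atBot.comp hn)
    simpa [sub_eq_add_neg] using this))
  have := le_of_tendsto_of_tendsto' L1 ((L2.add (L3.neg.add L4)).add_const X) hmain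
  have hpos : 0 ≤ X := by positivity
  have hX2 : X + X = K * (1 + lam ^ 2 * dx ^ 2 / 4) * ε ^ 4 := by rw [hX]; ring
  linarith

theorem discrete_stability
    (ε lam a dx T K : ℝ) (hε : 0 < ε) (hlam : 0 < lam) (hdx : 0 < dx)
    (hT : 0 < T) (hK : 0 < K) (hsub : ε * |a| < lam)
    (u v ub vb : ℤ → ℝ → ℝ)
    -- (u_i, v_i) solves the semi-discrete HLL scheme on [0,T)
    (hscheme_u : ∀ (i : ℤ), ∀ t ∈ Set.Ico (0:ℝ) T, HasDerivAt (fun τ => u i τ)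
      (-(v (i + 1) t - v (i - 1) t) / (2 * dx)
        + lam / (2 * dx) * (u (i + 1) t - 2 * u i t + u (i - 1) t)) t)
    (hscheme_v : ∀ (i : ℤ), ∀ t ∈ Set.Ico (0:ℝ) T, HasDerivAt (fun τ => v i τ)
      (-(lam ^ 2 / (2 * ε ^ 2 * dx)) * (u (i + 1) t - u (i - 1) t)
        + lam / (2 * dx) * (v (i + 1) t - 2 * v i t + v (i - 1) t)
        + (a * u i t - v i t) / ε ^ 2) t)
    -- (ū_i, v̄_i) is a smooth solution of the semi-discrete limit scheme
    (hlim_u : ∀ (i : ℤ), ∀ t ∈ Set.Ico (0:ℝ) T, HasDerivAt (fun τ => ub i τ)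
      (-(vb (i + 1) t - vb (i - 1) t) / (2 * dx)
        + lam / (2 * dx) * (ub (i + 1) t - 2 * ub i t + ub (i - 1) t)) t)
    (hlim_v : ∀ (i : ℤ), ∀ t ∈ Set.Ico (0:ℝ) T,
      lam ^ 2 / (2 * dx) * (ub (i + 1) t - ub (i - 1) t) = a * ub i t - vb i t)
    (hvb_diff : ∀ i : ℤ, Differentiable ℝ (fun τ => vb i τ))
    -- (i) decay conditions as i → ±∞
    (hdecay_u : ∀ t ∈ Set.Ico (0:ℝ) T,
      Tendsto (fun i : ℤ => u i t - ub i t) atTop (nhds 0) ∧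
      Tendsto (fun i : ℤ => u i t - ub i t) atBot (nhds 0))
    (hdecay_v : ∀ t ∈ Set.Ico (0:ℝ) T,
      Tendsto (fun i : ℤ => v i t - vb i t) atTop (nhds 0) ∧
      Tendsto (fun i : ℤ => v i t - vb i t) atBot (nhds 0))
    -- the telescoping sums of the discrete relative entropy fluxes vanish
    (hdecay_F : ∀ t ∈ Set.Ico (0:ℝ) T,
      Tendsto (fun i : ℤ => discreteRelEntropyFlux ε lam a u v ub vb i t)
        atTop (nhds 0) ∧
      Tendsto (fun i : ℤ => discreteRelEntropyFlux ε lam a u v ub vb i t)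
        atBot (nhds 0))
    -- convergence of all the series appearing
    (hsum_u : ∀ t ∈ Set.Ico (0:ℝ) T, Summable (fun i : ℤ => (u i t - ub i t) ^ 2))
    (hsum_v : ∀ t ∈ Set.Ico (0:ℝ) T, Summable (fun i : ℤ => (v i t - vb i t) ^ 2))
    (hsum_Dxu : ∀ t ∈ Set.Ico (0:ℝ) T,
      Summable (fun i : ℤ => (Dx dx (fun j => u j t - ub j t) i) ^ 2))
    (hsum_Dxv : ∀ t ∈ Set.Ico (0:ℝ) T,
      Summable (fun i : ℤ => (Dx dx (fun j => v j t - vb j t) i) ^ 2))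
    (hsum_Dxxvb : ∀ t ∈ Set.Ico (0:ℝ) T,
      Summable (fun i : ℤ => (Dxx dx (fun j => vb j t) i) ^ 2))
    (hsum_dtvb : ∀ t ∈ Set.Ico (0:ℝ) T,
      Summable (fun i : ℤ => (deriv (fun τ => vb i τ) t) ^ 2))
    (hint_diss : ∀ t ∈ Set.Ico (0:ℝ) T, IntervalIntegrable
      (fun s => ∑' i : ℤ,
        dx * (a * (u i s - ub i s) - (v i s - vb i s)) ^ 2)
      MeasureTheory.volume 0 t)
    (hint_Dxu : ∀ t ∈ Set.Ico (0:ℝ) T, IntervalIntegrable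
      (fun s => ∑' i : ℤ, dx * (Dx dx (fun j => u j s - ub j s) i) ^ 2)
      MeasureTheory.volume 0 t)
    (hint_Dxv : ∀ t ∈ Set.Ico (0:ℝ) T, IntervalIntegrable
      (fun s => ∑' i : ℤ, dx * (Dx dx (fun j => v j s - vb j s) i) ^ 2)
      MeasureTheory.volume 0 t)
    -- (ii) the bounds ‖dv̄/dt‖²_{L²(Q_T)} ≤ K and ‖D_{xx}v̄‖²_{L²(Q_T)} ≤ K
    (hK1 : (∫ s in (0:ℝ)..T, ∑' i : ℤ, dx * (deriv (fun τ => vb i τ) s) ^ 2) ≤ K)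
    (hK2 : (∫ s in (0:ℝ)..T, ∑' i : ℤ, dx * (Dxx dx (fun j => vb j s) i) ^ 2) ≤ K)
    -- (iii) φ(0) < ∞
    (hphi0 : Summable (fun i : ℤ => discreteRelEntropy ε lam a u v ub vb i 0))
    (hphit : ∀ t ∈ Set.Ico (0:ℝ) T,
      Summable (fun i : ℤ => discreteRelEntropy ε lam a u v ub vb i t)) :
    (∀ t ∈ Set.Ico (0:ℝ) T,
      discretePhi ε lam a dx u v ub vb t
        ≤ discretePhi ε lam a dx u v ub vb 0
          + K * (1 + lam ^ 2 * dx ^ 2 / 4) * ε ^ 4)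
    ∧ ∃ B : ℝ, 0 < B ∧ ∀ t ∈ Set.Ico (0:ℝ) T,
        discretePhi ε lam a dx u v ub vb t
          ≤ discretePhi ε lam a dx u v ub vb 0 + B * ε ^ 4 := by
  have h0T : (0:ℝ) ∈ Set.Ico 0 T := ⟨le_rfl, hT⟩
  set c1 : ℝ := lam ^ 2 / (4 * dx ^ 2) with hc1
  set c2 : ℝ := -a / (2 * dx) + lam / (2 * dx) with hc2
  set c3 : ℝ := -lam ^ 2 / (2 * dx ^ 2) - lam / dx with hc3
  set c4 : ℝ := a / (2 * dx) + lam / (2 * dx) with hc4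
  set y : ℤ → ℝ → ℝ := fun i t => deriv (fun τ => vb i τ) t with hy
  set z : ℤ → ℝ → ℝ := fun i t => Dxx dx (fun j => vb j t) i with hz
  have hvbd : ∀ i t, HasDerivAt (fun τ => vb i τ) (y i t) t := fun i t =>
    (hvb_diff i t).hasDerivAt
  -- the limit scheme closes on `vb`
  have hyst : ∀ i, ∀ t ∈ Set.Ico 0 T, y i t =
      c1 * vb (i + 2) t + c2 * vb (i + 1) t + c3 * vb i t + c4 * vb (i - 1) t
        + c1 * vb (i - 2) t := by
    intro i t ht
    have hrel : ∀ s ∈ Set.Ico 0 T, vb i s =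
        a * ub i s - lam ^ 2 / (2 * dx) * (ub (i + 1) s - ub (i - 1) s) := fun s hs => by
      linarith [hlim_v i s hs]
    have hd := ((((hlim_u i t ht).const_mul a).sub
      (((hlim_u (i + 1) t ht).sub (hlim_u (i - 1) t ht)).const_mul
        (lam ^ 2 / (2 * dx)))).hasDerivWithinAt (s := Set.Ico 0 T)).congr hrel (hrel t ht)
    have hu := (uniqueDiffOn_Ico (0:ℝ) T t ht).eq_deriv _ (hvbd i t).hasDerivWithinAt hd
    rw [hu]
    have e1 := hlim_v i t ht
    have e2 := hlim_v (i + 1) t ht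
    have e3 := hlim_v (i - 1) t ht
    have i1 : i + 1 + 1 = i + 2 := by ring
    have i2 : i + 1 - 1 = i := by ring
    have i3 : i - 1 + 1 = i := by ring
    have i4 : i - 1 - 1 = i - 2 := by ring
    rw [i1, i2] at e2
    rw [i3, i4] at e3
    rw [i1, i2, i3, i4]
    simp only [hc1, hc2, hc3, hc4]
    have f1 : vb i t = a * ub i t - lam ^ 2 / (2 * dx) * (ub (i + 1) t - ub (i - 1) t) := by
      linarith
    have f2 : vb (i + 1) t = a * ub (i + 1) t - lam ^ 2 / (2 * dx) * (ub (i + 2) t - ub i t) := by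
      linarith
    have f3 : vb (i - 1) t = a * ub (i - 1) t - lam ^ 2 / (2 * dx) * (ub i t - ub (i - 2) t) := by
      linarith
    have hne : dx ≠ 0 := hdx.ne'
    rw [show -lam ^ 2 / (2 * dx ^ 2) - lam / dx = -lam ^ 2 / (2 * dx ^ 2) - 2 * (lam / (2 * dx)) by
      field_simp]
    linear_combination (-(lam / (2 * dx))) * (f2 - 2 * f1 + f3)
  have hvbd' : ∀ i, ∀ t ∈ Set.Ico 0 T, HasDerivWithinAt (fun τ => vb i τ)
      (c1 * vb (i + 2) t + c2 * vb (i + 1) t + c3 * vb i t + c4 * vb (i - 1) t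
        + c1 * vb (i - 2) t) (Set.Ico 0 T) t := fun i t ht =>
    (hyst i t ht) ▸ (hvbd i t).hasDerivWithinAt
  have hyd : ∀ i, ∀ t ∈ Set.Ico 0 T, HasDerivWithinAt (y i)
      (c1 * y (i + 2) t + c2 * y (i + 1) t + c3 * y i t + c4 * y (i - 1) t + c1 * y (i - 2) t)
      (Set.Ico 0 T) t := by
    intro i t ht
    have hd := (((((hvbd (i + 2) t).const_mul c1).add ((hvbd (i + 1) t).const_mul c2)).add
      ((hvbd i t).const_mul c3)).add ((hvbd (i - 1) t).const_mul c4)).add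
      ((hvbd (i - 2) t).const_mul c1)
    exact hd.hasDerivWithinAt.congr (hyst i) (hyst i t ht)
  have hzd : ∀ i, ∀ t ∈ Set.Ico 0 T, HasDerivWithinAt (z i)
      (c1 * z (i + 2) t + c2 * z (i + 1) t + c3 * z i t + c4 * z (i - 1) t + c1 * z (i - 2) t)
      (Set.Ico 0 T) t := by
    intro i t ht
    have hd := (((hvbd' (i + 1) t ht).sub ((hvbd' i t ht).const_mul 2)).add
      (hvbd' (i - 1) t ht)).div_const (dx ^ 2)
    refine HasDerivWithinAt.congr_deriv (f := z i) hd ?_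
    simp only [hz, Dxx]
    have i1 : i + 1 + 2 = i + 2 + 1 := by ring
    have i2 : i + 1 + 1 = i + 2 := by ring
    have i3 : i + 1 - 1 = i := by ring
    have i4 : i + 1 - 2 = i - 1 := by ring
    have i5 : i - 1 + 2 = i + 1 := by ring
    have i6 : i - 1 + 1 = i := by ring
    have i7 : i - 1 - 1 = i - 2 := by ring
    have i8 : i - 1 - 2 = i - 2 - 1 := by ring
    have i9 : i + 2 - 1 = i + 1 := by ring
    have i10 : i - 2 + 1 = i - 1 := by ring
    simp only [i1, i2, i3, i4, i5, i6, i7, i8, i9, i10]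
    ring
  obtain ⟨By, hBy0, hBy⟩ := stencil_bdd T hT c1 c2 c3 c4 c1 y hyd hsum_dtvb
  obtain ⟨Bz, hBz0, hBz⟩ := stencil_bdd T hT c1 c2 c3 c4 c1 z hzd hsum_Dxxvb
  have hyc : ∀ i, ContinuousOn (y i) (Set.Ico 0 T) := fun i t ht =>
    (hyd i t ht).continuousWithinAt
  have hzc : ∀ i, ContinuousOn (z i) (Set.Ico 0 T) := fun i t ht =>
    (hzd i t ht).continuousWithinAt
  set p : ℤ → ℝ → ℝ := fun i t => u i t - ub i t with hp
  set q : ℤ → ℝ → ℝ := fun i t => v i t - vb i t with hq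
  have hpd : ∀ i, ∀ t ∈ Set.Ico 0 T, HasDerivAt (p i)
      (-(q (i + 1) t - q (i - 1) t) / (2 * dx)
        + lam / (2 * dx) * (p (i + 1) t - 2 * p i t + p (i - 1) t)) t := by
    intro i t ht
    refine ((hscheme_u i t ht).sub (hlim_u i t ht)).congr_deriv ?_
    simp only [hp, hq]
    ring
  have hqd : ∀ i, ∀ t ∈ Set.Ico 0 T, HasDerivAt (q i)
      (-(lam ^ 2 / (2 * ε ^ 2 * dx)) * (p (i + 1) t - p (i - 1) t)
        + lam / (2 * dx) * (q (i + 1) t - 2 * q i t + q (i - 1) t)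
        + (a * p i t - q i t) / ε ^ 2 + (lam * dx / 2 * z i t - y i t)) t := by
    intro i t ht
    refine ((hscheme_v i t ht).sub (hvbd i t)).congr_deriv ?_
    have e1 := hlim_v i t ht
    have e2 : lam ^ 2 / (2 * ε ^ 2 * dx) * (ub (i + 1) t - ub (i - 1) t)
        = (a * ub i t - vb i t) / ε ^ 2 := by
      rw [← e1]; field_simp
    have e3 : lam * dx / 2 * z i t = lam / (2 * dx) * (vb (i + 1) t - 2 * vb i t + vb (i - 1) t) := by
      simp only [hz, Dxx]; field_simp
    rw [e3]
    simp only [hp, hq]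
    linear_combination (-1) * e2
  have hR : ∀ t ∈ Set.Ico 0 T, ∀ S : Finset ℤ, ∑ i ∈ S, (lam * dx / 2 * z i t - y i t) ^ 2 ≤
      2 * (lam * dx / 2) ^ 2 * Bz + 2 * By := by
    intro t ht S
    have k1 := ((hsum_dtvb t ht).sum_le_tsum S fun i _ => sq_nonneg _).trans (hBy t ht)
    have k2 := ((hsum_Dxxvb t ht).sum_le_tsum S fun i _ => sq_nonneg _).trans (hBz t ht)
    calc ∑ i ∈ S, (lam * dx / 2 * z i t - y i t) ^ 2
        ≤ ∑ i ∈ S, (2 * (lam * dx / 2) ^ 2 * (z i t) ^ 2 + 2 * (y i t) ^ 2) :=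
          Finset.sum_le_sum fun i _ => by
            nlinarith [sq_nonneg (lam * dx / 2 * z i t + y i t)]
      _ = 2 * (lam * dx / 2) ^ 2 * ∑ i ∈ S, (z i t) ^ 2 + 2 * ∑ i ∈ S, (y i t) ^ 2 := by
          rw [Finset.sum_add_distrib, Finset.mul_sum, Finset.mul_sum]
      _ ≤ _ := by
          refine add_le_add (mul_le_mul_of_nonneg_left k2 (by positivity))
            (mul_le_mul_of_nonneg_left k1 (by norm_num))
  obtain ⟨B, hB0, hB⟩ := pq_bdd T hT (2 * dx) (lam / (2 * dx)) (lam ^ 2 / (2 * ε ^ 2 * dx)) a (ε ^ 2)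
    (2 * (lam * dx / 2) ^ 2 * Bz + 2 * By) (by positivity) p q
    (fun i t => lam * dx / 2 * z i t - y i t) hpd hqd hR hsum_u hsum_v
  have hmain : ∀ t ∈ Set.Ico (0:ℝ) T,
      discretePhi ε lam a dx u v ub vb t
        ≤ discretePhi ε lam a dx u v ub vb 0
          + K * (1 + lam ^ 2 * dx ^ 2 / 4) * ε ^ 4 := fun t ht =>
    core ε lam a dx T K hε hlam hdx hK hsub p q y z B hpd hqd hyc hzc hB hdecay_u hdecay_v
      (integral_partial_le T dx K By hdx y hyc hsum_dtvb hBy hK1)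
      (integral_partial_le T dx K Bz hdx z hzc hsum_Dxxvb hBz hK2)
      (discreteRelEntropy ε lam a u v ub vb) rfl hphit t ht
  exact ⟨hmain, K * (1 + lam ^ 2 * dx ^ 2 / 4), by positivity, hmain⟩
end
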